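/- In the p-player Zeckendorf game with two alliances and n ≥ 2p + 4b, if there is a positive integer b such that for every player i not in alliance a, player (i − b) mod p is in alliance a, and alliance a has at least 3b consecutive players, then alliance a has a winning strategy. -/

import Mathlib

/-- Fibonacci numbers indexed so that `zF 1 = 1`, `zF 2 = 2`,
`zF (i+1) = zF i + zF (i-1)`. -/
def zF (n : ℕ) : ℕ := Nat.fib (n + 1)

/-- The starting state of the Zeckendorf game on `n`: `n` copies of `F 1 = 1`.
States are multisets of indices `i`, the index `i` standing for `F i`. -/
def zstart (n : ℕ) : Multiset ℕ := Multiset.replicate n 1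

/-- Legal moves of the Zeckendorf game, on multisets of indices. -/
inductive ZMove : Multiset ℕ → Multiset ℕ → Prop
  | combine (i : ℕ) (M : Multiset ℕ) (hi : 2 ≤ i) :
      ZMove ({i - 1, i} + M) ({i + 1} + M)
  | combine1 (M : Multiset ℕ) : ZMove ({1, 1} + M) ({2} + M)
  | split2 (M : Multiset ℕ) : ZMove ({2, 2} + M) ({1, 3} + M)
  | split (i : ℕ) (M : Multiset ℕ) (hi : 3 ≤ i) :
      ZMove ({i, i} + M) ({i - 2, i + 1} + M)

/-- `ZWins p S t M` : in the `p`-player Zeckendorf game where move number `t`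
(counting from 0) is made by player `t % p`, the coalition `S` of players has a
strategy from state `M` at turn `t` guaranteeing that a member of `S` makes the
final move (the move producing a state with no legal moves). -/
inductive ZWins (p : ℕ) (S : Set ℕ) : ℕ → Multiset ℕ → Prop
  | mine_end (t : ℕ) (M M' : Multiset ℕ) (hS : t % p ∈ S) (hmv : ZMove M M')
      (h : ∀ N, ¬ ZMove M' N) : ZWins p S t M
  | mine_step (t : ℕ) (M M' : Multiset ℕ) (hS : t % p ∈ S) (hmv : ZMove M M')
      (h : ZWins p S (t + 1) M') : ZWins p S t M
  | theirs (t : ℕ) (M : Multiset ℕ) (hS : t % p ∉ S) (hne : ∃ M', ZMove M M')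
      (h : ∀ M', ZMove M M' → ZWins p S (t + 1) M') : ZWins p S t M

/-- The specific move `1 + 1 = 2`. -/
def MOneOne (M M' : Multiset ℕ) : Prop :=
  ({1, 1} : Multiset ℕ) ≤ M ∧ M' = M - {1, 1} + {2}

/-- The specific move `1 + 2 = 3`. -/
def MOneTwo (M M' : Multiset ℕ) : Prop :=
  ({1, 2} : Multiset ℕ) ≤ M ∧ M' = M - {1, 2} + {3}

/-- The specific move `2 + 2 = 1 + 3`. -/
def MTwoTwo (M M' : Multiset ℕ) : Prop :=
  ({2, 2} : Multiset ℕ) ≤ M ∧ M' = M - {2, 2} + {1, 3}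

/-- A weight on indices which strictly decreases in total along every legal move. -/
def zweight (i : ℕ) : ℕ := if i = 1 then 3 else i + 3

theorem ZMove.weight_lt {M M' : Multiset ℕ} (h : ZMove M M') :
    (M'.map zweight).sum < (M.map zweight).sum := by
  cases h with
  | combine i M hi => simp [zweight]; grind
  | combine1 M => simp [zweight]; omega
  | split2 M => simp [zweight]; omega
  | split i M hi => simp [zweight]; grind

theorem ZMove.count_one_le {M M' : Multiset ℕ} (h : ZMove M M') :
    M.count 1 ≤ M'.count 1 + 2 := by
  cases h with
  | combine i M hi => simp [Multiset.count_cons]; grind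
  | combine1 M => simp
  | split2 M => simp; omega
  | split i M hi => simp [Multiset.count_cons]; grind

theorem exists_zmove_of_two_le_count_one {M : Multiset ℕ} (h : 2 ≤ M.count 1) :
    ∃ M', ZMove M M' := by
  obtain ⟨R, rfl⟩ := Multiset.le_iff_exists_add.mp (Multiset.le_count_iff_replicate_le.mp h)
  exact ⟨_, ZMove.combine1 R⟩

/-- From a non-terminal state, one of the two alliances has a winning strategy. -/
theorem ZWins.or_compl (p : ℕ) (S : Set ℕ) (M : Multiset ℕ) :
    ∀ t, (∃ M', ZMove M M') → ZWins p S t M ∨ ZWins p Sᶜ t M := by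
  induction hw : (M.map zweight).sum using Nat.strong_induction_on generalizing M with
  | _ w ih =>
    subst hw
    intro t hne
    have key : ∀ T : Set ℕ, (∀ M', ZMove M M' → (∃ N, ZMove M' N) →
        ZWins p T (t + 1) M' ∨ ZWins p Tᶜ (t + 1) M') → t % p ∈ T →
        ZWins p T t M ∨ ZWins p Tᶜ t M := by
      intro T hT ht
      by_contra! hcon
      refine hcon.2 (.theirs t M (by simpa using ht) hne fun M' hM' => ?_)
      by_cases hN : ∃ N, ZMove M' N
      · exact (hT M' hM' hN).resolve_left fun h => hcon.1 (.mine_step t M M' ht hM' h)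
      · exact (hcon.1 (.mine_end t M M' ht hM' (not_exists.mp hN))).elim
    by_cases ht : t % p ∈ S
    · exact key S (fun M' hM' hN => ih _ hM'.weight_lt M' rfl _ hN) ht
    · have := key Sᶜ (fun M' hM' hN => by
        rw [compl_compl]; exact (ih _ hM'.weight_lt M' rfl _ hN).symm) ht
      rw [compl_compl] at this
      exact this.symm

/-- Strategy stealing: an alliance which moves, after a shift of turns, at least whenever a
winning alliance would have moved, wins as well. -/
theorem ZWins.steal {p : ℕ} {S T : Set ℕ} {t : ℕ} {M : Multiset ℕ} (h : ZWins p S t M) :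
    ∀ t', (∀ k, (t + k) % p ∈ S → (t' + k) % p ∈ T) → ZWins p T t' M := by
  have shift : ∀ {t t' : ℕ}, (∀ k, (t + k) % p ∈ S → (t' + k) % p ∈ T) →
      ∀ k, (t + 1 + k) % p ∈ S → (t' + 1 + k) % p ∈ T := by
    intro t t' H k
    simpa only [add_assoc] using H (1 + k)
  induction h with
  | mine_end t M M' hS hmv hend =>
    intro t' H
    exact .mine_end t' M M' (H 0 hS) hmv hend
  | mine_step t M M' hS hmv _ ih =>
    intro t' H
    exact .mine_step t' M M' (H 0 hS) hmv (ih _ (shift H))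
  | theirs t M hS hne _ ih =>
    intro t' H
    by_cases ht : t' % p ∈ T
    · obtain ⟨M', hM'⟩ := hne
      exact .mine_step t' M M' ht hM' (ih M' hM' _ (shift H))
    · exact .theirs t' M ht hne fun M' hM' => ih M' hM' _ (shift H)

/-- An alliance holding `k` consecutive turns may play the same move `k` times. -/
theorem ZWins.of_repeat_move {p : ℕ} {S : Set ℕ} {a c : Multiset ℕ}
    (hac : ∀ M, ZMove (a + M) (c + M)) (k : ℕ) :
    ∀ {t : ℕ} {M : Multiset ℕ}, (∀ j < k, (t + j) % p ∈ S) →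
      ZWins p S (t + k) (k • c + M) → ZWins p S t (k • a + M) := by
  induction k with
  | zero => intro t M _ h; simpa using h
  | succ k ih =>
    intro t M hS h
    rw [succ_nsmul', add_assoc]
    refine .mine_step t _ _ (hS 0 k.succ_pos) (hac _) ?_
    rw [add_left_comm]
    refine ih (fun j hj => ?_) ?_
    · simpa only [add_assoc, add_comm 1 j] using hS (j + 1) (by omega)
    · convert h using 1
      · omega
      · rw [succ_nsmul, add_assoc]

/-- An alliance holding `3 * b` consecutive turns wins from any state with enough ones, by
choosing at which of two turns the same state is reached. -/
theorem ZWins.of_block {p b t : ℕ} {S : Set ℕ} (hS : ∀ k < 3 * b, (t + k) % p ∈ S)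
    (hshift : ∀ k, k % p ∉ S → (k + b) % p ∈ S) {M : Multiset ℕ}
    (hM : 4 * b + 2 ≤ M.count 1) : ZWins p S t M := by
  obtain ⟨R, rfl⟩ := Multiset.le_iff_exists_add.mp
    (Multiset.le_count_iff_replicate_le.mp ((Nat.le_add_right (4 * b) 2).trans hM))
  have pair : ∀ x y : ℕ, ({x, y} : Multiset ℕ) = {x} + {y} := fun _ _ => rfl
  rw [← Multiset.nsmul_singleton] at hM ⊢
  have early : ZWins p S (t + 2 * b) (b • {1, 3} + R) → ZWins p S t ((4 * b) • {1} + R) := by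
    intro h
    have h₁ : ZWins p S (t + b) (b • {1, 2} + (b • {1} + R)) := by
      refine .of_repeat_move (c := {3}) (fun M => ZMove.combine 2 M le_rfl) b
        (fun j hj => by simpa only [add_assoc] using hS (b + j) (by omega)) ?_
      convert h using 1
      · omega
      · rw [pair]; module
    have h₂ : ZWins p S t (b • {1, 1} + ((2 * b) • {1} + R)) := by
      refine .of_repeat_move ZMove.combine1 b (fun j hj => hS j (by omega)) ?_
      convert h₁ using 1
      rw [pair]; module
    convert h₂ using 1
    rw [pair]; module
  have late : ZWins p S (t + 3 * b) (b • {1, 3} + R) → ZWins p S t ((4 * b) • {1} + R) := by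
    intro h
    have h₁ : ZWins p S (t + 2 * b) (b • {2, 2} + R) := by
      refine .of_repeat_move ZMove.split2 b
        (fun j hj => by simpa only [add_assoc] using hS (2 * b + j) (by omega)) ?_
      convert h using 1
      omega
    have h₂ : ZWins p S t ((2 * b) • {1, 1} + R) := by
      refine .of_repeat_move ZMove.combine1 (2 * b) (fun j hj => hS j (by omega)) ?_
      convert h₁ using 1
      rw [pair]; module
    convert h₂ using 1
    rw [pair]; module
  have hne : ∃ M', ZMove (b • {1, 3} + R) M' := by
    apply exists_zmove_of_two_le_count_one
    simp only [Multiset.count_add, Multiset.count_nsmul, Multiset.count_singleton_self] at hM ⊢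
    omega
  rcases ZWins.or_compl p S _ (t + 2 * b) hne with h | h
  · exact early h
  · refine late (h.steal _ fun k hk => ?_)
    convert hshift (t + 2 * b + k) hk using 2
    omega

/-- An alliance that wins at turn `t + d` from every state with enough ones wins at turn `t` from
every state with `2 * d` more ones. -/
theorem ZWins.of_later {p m : ℕ} {S : Set ℕ} (hm : 2 ≤ m) (d : ℕ) :
    ∀ {t : ℕ} {M : Multiset ℕ}, (∀ N : Multiset ℕ, m ≤ N.count 1 → ZWins p S (t + d) N) →
      2 * d + m ≤ M.count 1 → ZWins p S t M := by
  induction d with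
  | zero => intro t M h hM; exact h M (by omega)
  | succ d ih =>
    intro t M h hM
    have next : ∀ M', ZMove M M' → ZWins p S (t + 1) M' := fun M' hM' =>
      ih (fun N hN => by simpa only [add_assoc, add_comm 1 d] using h N hN)
        (by have := hM'.count_one_le; omega)
    have hne := exists_zmove_of_two_le_count_one (M := M) (by omega)
    by_cases ht : t % p ∈ S
    · obtain ⟨M', hM'⟩ := hne
      exact .mine_step t M M' ht hM' (next M' hM')
    · exact .theirs t M ht hne next

/-- In the `p`-player two-alliance Zeckendorf game with `n ≥ 2p + 4b`, if every
player `i` not in alliance `A` has player `(i - b) mod p` in `A`, and `A` has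
at least `3b` consecutive players (cyclically), then `A` has a winning
strategy. -/
theorem stmt_15 (p n b : ℕ) (hp : 0 < p) (hb : 0 < b)
    (hn : 2 * p + 4 * b ≤ n)
    (A : Finset ℕ) (hA : A ⊆ Finset.range p)
    (hshift : ∀ i < p, i ∉ A → ∃ j ∈ A, (j + b) % p = i)
    (s : ℕ) (hconsec : ∀ k < 3 * b, (s + k) % p ∈ A) :
    ZWins p (↑A) 0 (zstart n) := by
  have hlt : s % p < p := Nat.mod_lt s hp
  refine ZWins.of_later (m := 4 * b + 2) (by omega) (s % p) (fun N hN => ?_) ?_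
  · refine ZWins.of_block (b := b) (fun k hk => ?_) (fun k hk => ?_) hN
    · simpa using hconsec k hk
    · by_contra hkb
      obtain ⟨j, hj, hjk⟩ := hshift ((k + b) % p) (Nat.mod_lt _ hp) (by simpa using hkb)
      have hmod : j % p = k % p := Nat.ModEq.add_right_cancel' b hjk
      rw [Nat.mod_eq_of_lt (Finset.mem_range.mp (hA hj))] at hmod
      exact hk (by simpa [← hmod] using hj)
  · simp only [zstart, Multiset.count_replicate_self]
    omega
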